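/- If α ∈ (0, π/2) and w ∈ S^{n-1}, then the convex cone C = {x ∈ R^n : ⟨x,w⟩ ≥ ‖x‖ cos α} satisfies γ_n(C) ≥ sin^{n-1}(α) / √(2πn), where γ_n is the standard Gaussian measure on R^n. -/

import Mathlib

open MeasureTheory
open scoped RealInnerProductSpace

/-- The standard Gaussian measure on `ℝ^n`. -/
noncomputable def gaussianMeasure (n : ℕ) : Measure (EuclideanSpace ℝ (Fin n)) :=
  volume.withDensity
    (fun x => ENNReal.ofReal ((2 * Real.pi) ^ (-(n : ℝ) / 2) * Real.exp (-‖x‖ ^ 2 / 2)))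

lemma aux_split (m : ℕ) (w : EuclideanSpace ℝ (Fin (m+1))) (hw : ‖w‖ = 1) :
    ∃ Φ : EuclideanSpace ℝ (Fin (m+1)) → ℝ × EuclideanSpace ℝ (Fin m),
      MeasurePreserving Φ volume volume ∧ (∀ x, (Φ x).1 = ⟪x, w⟫) ∧
      ∀ x, ‖x‖ ^ 2 = (Φ x).1 ^ 2 + ‖(Φ x).2‖ ^ 2 := by
  obtain ⟨b, hb⟩ := Orthonormal.exists_orthonormalBasis_extension_of_card_eq (𝕜 := ℝ)
    (E := EuclideanSpace ℝ (Fin (m+1))) (ι := Fin (m+1)) (by simp) (v := fun _ => w) (s := {0})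
    (by
      constructor
      · intro i; simpa using hw
      · intro i j hij; exact absurd (Subsingleton.elim i j) hij)
  have hb0 : b 0 = w := hb 0 (by simp)
  have h1 := b.measurePreserving_repr
  have h2 := PiLp.volume_preserving_ofLp (Fin (m+1))
  have h3 := volume_preserving_piFinSuccAbove (fun _ : Fin (m+1) => ℝ) 0
  have h4 : MeasurePreserving (Prod.map (id : ℝ → ℝ) (WithLp.toLp 2 : (Fin m → ℝ) → EuclideanSpace ℝ (Fin m)))
     volume volume :=
    (MeasurePreserving.id volume).prod (PiLp.volume_preserving_toLp (Fin m))
  refine ⟨_, h4.comp (h3.comp (h2.comp h1)), ?_, ?_⟩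
  · intro x
    simp [MeasurableEquiv.piFinSuccAbove, Fin.insertNthEquiv, b.repr_apply_apply, hb0, real_inner_comm]
  · intro x
    rw [← b.repr.norm_map x, EuclideanSpace.norm_sq_eq, Fin.sum_univ_succ, EuclideanSpace.norm_sq_eq]
    simp [MeasurableEquiv.piFinSuccAbove, Fin.insertNthEquiv, Fin.tail]

lemma aux_scale (g : ℝ → ENNReal) (hg : Measurable g) (r : ℝ) (hr : 0 < r) :
    ∫⁻ t, g t = ENNReal.ofReal r * ∫⁻ u, g (r * u) := by
  conv_lhs => rw [← Real.smul_map_volume_mul_left hr.ne']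
  rw [lintegral_smul_measure, lintegral_map hg (by fun_prop), abs_of_pos hr, smul_eq_mul]

lemma aux_norm (m : ℕ) (hm : 1 ≤ m) (b : ℝ) (hb : 0 < b) :
    ∫⁻ y : EuclideanSpace ℝ (Fin m), ENNReal.ofReal (‖y‖ * Real.exp (-b * ‖y‖ ^ 2)) =
     ENNReal.ofReal (m * (√Real.pi ^ m / Real.Gamma (m / 2 + 1)) *
       (b ^ (-((m:ℝ) + 1) / 2) * (1 / 2) * Real.Gamma (((m:ℝ) + 1) / 2))) := by
  have : Nonempty (Fin m) := ⟨⟨0, hm⟩⟩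
  have : Nontrivial (EuclideanSpace ℝ (Fin m)) := inferInstance
  have e : Set.EqOn (fun y : ℝ => y ^ (m - 1) • (y * Real.exp (-b * y ^ 2)))
      (fun y => y ^ (m:ℝ) * Real.exp (-b * y ^ (2:ℝ))) (Set.Ioi 0) := by
    intro y hy
    obtain ⟨k, rfl⟩ : ∃ k, m = k + 1 := ⟨m - 1, by omega⟩
    simp only [smul_eq_mul]
    rw [Real.rpow_natCast, Real.rpow_two, ← mul_assoc, ← pow_succ]
    rfl
  have hm0 : (-1:ℝ) < m := by have : (0:ℝ) ≤ m := by positivity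
                              linarith
  have hi : Integrable (fun y : EuclideanSpace ℝ (Fin m) => ‖y‖ * Real.exp (-b * ‖y‖ ^ 2)) := by
    rw [integrable_fun_norm_addHaar volume (f := fun y => y * Real.exp (-b * y ^ 2))]
    rw [finrank_euclideanSpace_fin]
    rw [integrableOn_congr_fun e measurableSet_Ioi]
    exact integrableOn_rpow_mul_exp_neg_mul_rpow hm0 two_pos hb
  rw [← ofReal_integral_eq_lintegral_ofReal hi (.of_forall fun y => by positivity)]
  rw [integral_fun_norm_addHaar volume (fun y => y * Real.exp (-b * y ^ 2)), finrank_euclideanSpace_fin,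
    setIntegral_congr_fun measurableSet_Ioi e, integral_rpow_mul_exp_neg_mul_rpow two_pos hm0 hb]
  have : volume.real (Metric.ball (0 : EuclideanSpace ℝ (Fin m)) 1) = √Real.pi ^ m / Real.Gamma (m / 2 + 1) := by
    rw [Measure.real, EuclideanSpace.volume_ball]
    simp
    positivity
  rw [this, nsmul_eq_mul, smul_eq_mul, ← mul_assoc]

lemma aux_tail (m : ℕ) (hm : 1 ≤ m) (α : ℝ) (hα : 0 < α) (hα' : α < Real.pi / 2) :
    ENNReal.ofReal (Real.sin α ^ m / m) ≤
    ∫⁻ u in Set.Ioi (Real.cos α / Real.sin α), ENNReal.ofReal ((1 + u ^ 2) ^ (-((m:ℝ) + 1) / 2)) := by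
  have hs : 0 < Real.sin α := Real.sin_pos_of_pos_of_lt_pi hα (by linarith)
  have hc : 0 < Real.cos α := Real.cos_pos_of_mem_Ioo ⟨by linarith, hα'⟩
  have hm0 : (0:ℝ) < m := by exact_mod_cast hm
  set c := Real.cos α / Real.sin α
  have hcp : 0 < c := by positivity
  let g : ℝ → ℝ := fun u => (1 + u ^ 2) ^ (-(m:ℝ) / 2) / m
  let g' : ℝ → ℝ := fun u => - (u * (1 + u ^ 2) ^ (-(m:ℝ) / 2 - 1))
  have hd : ∀ x ∈ Set.Ici c, HasDerivAt g (g' x) x := by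
    intro x _
    have h1 : HasDerivAt (fun u : ℝ => 1 + u ^ 2) (2 * x) x := by
      simpa using (hasDerivAt_pow 2 x).const_add 1
    have := (h1.rpow_const (p := -(m:ℝ) / 2) (Or.inl (by positivity))).div_const (m:ℝ)
    refine this.congr_deriv ?_
    simp only [g']
    field_simp
  have hneg : ∀ x ∈ Set.Ioi c, g' x ≤ 0 := by
    intro x hx
    have : 0 < x := hcp.trans hx
    simp only [g']
    have : 0 < x * (1 + x ^ 2) ^ (-(m:ℝ) / 2 - 1) := by positivity
    linarith
  have ht : Filter.Tendsto g Filter.atTop (nhds 0) := by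
    have h1 : Filter.Tendsto (fun u : ℝ => 1 + u ^ 2) Filter.atTop Filter.atTop :=
      Filter.tendsto_atTop_add_const_left _ _ (Filter.tendsto_pow_atTop two_ne_zero)
    have h2 := (tendsto_rpow_neg_atTop (y := (m:ℝ) / 2) (by positivity)).comp h1
    have := h2.div_const (m:ℝ)
    simpa [g, Function.comp_def, neg_div] using this
  have hint := integrableOn_Ioi_deriv_of_nonpos' hd hneg ht
  have hval := integral_Ioi_of_hasDerivAt_of_nonpos' hd hneg ht
  have hgc : g c = Real.sin α ^ m / m := by
    have : 1 + c ^ 2 = (Real.sin α ^ 2)⁻¹ := by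
      have := Real.sin_sq_add_cos_sq α
      simp only [c]
      field_simp
      linarith
    simp only [g, this]
    rw [Real.inv_rpow (by positivity), ← Real.rpow_neg (by positivity), ← Real.rpow_natCast _ 2, ← Real.rpow_mul hs.le]
    congr 1
    rw [← Real.rpow_natCast]
    congr 1
    push_cast
    ring
  have : Real.sin α ^ m / m = ∫ x in Set.Ioi c, - g' x := by
    rw [integral_neg, hval, hgc]; ring
  rw [this, ofReal_integral_eq_lintegral_ofReal (f := fun x => -g' x) hint.neg]
  · refine setLIntegral_mono' measurableSet_Ioi fun x hx => ENNReal.ofReal_le_ofReal ?_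
    have hx0 : 0 < x := hcp.trans hx
    simp only [g', neg_neg]
    have hx1 : x ≤ (1 + x ^ 2) ^ (1/2:ℝ) := by
      rw [← Real.sqrt_eq_rpow]; exact Real.le_sqrt_of_sq_le (by linarith)
    calc x * (1 + x ^ 2) ^ (-(m:ℝ) / 2 - 1) ≤ (1 + x ^ 2) ^ (1/2:ℝ) * (1 + x ^ 2) ^ (-(m:ℝ) / 2 - 1) := by gcongr
      _ = _ := by
        rw [← Real.rpow_add (by positivity)]
        congr 1; ring
  · exact (ae_restrict_mem measurableSet_Ioi).mono fun x hx => by simpa using hneg x hx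

lemma aux_const (m : ℕ) (hm : 1 ≤ m) (s : ℝ) (hs : 0 < s) :
   s ^ m / √(2 * Real.pi * (m + 1)) ≤
   ((2 * Real.pi) ^ (-((m:ℝ) + 1) / 2) * (m * (√Real.pi ^ m / Real.Gamma (m / 2 + 1)) *
       ((1/2:ℝ) ^ (-((m:ℝ) + 1) / 2) * (1 / 2) * Real.Gamma (((m:ℝ) + 1) / 2)))) * (s ^ m / m) := by
  have hm0 : (0:ℝ) < m := by exact_mod_cast hm
  have hpi := Real.pi_pos
  have hG1 : 0 < Real.Gamma (((m:ℝ) + 1) / 2) := Real.Gamma_pos_of_pos (by positivity)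
  have hG2 : 0 < Real.Gamma ((m:ℝ) / 2 + 1) := Real.Gamma_pos_of_pos (by positivity)
  have hG : Real.Gamma ((m:ℝ) / 2 + 1) ≤ Real.Gamma (((m:ℝ) + 1) / 2) * √(((m:ℝ) + 1) / 2) := by
    have h := Real.Gamma_mul_add_mul_le_rpow_Gamma_mul_rpow_Gamma (s := ((m:ℝ) + 1) / 2)
      (t := ((m:ℝ) + 1) / 2 + 1) (a := 1/2) (b := 1/2) (by positivity) (by positivity)
      (by norm_num) (by norm_num) (by norm_num)
    rw [Real.Gamma_add_one (by positivity), ← Real.sqrt_eq_rpow, ← Real.sqrt_eq_rpow,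
      Real.sqrt_mul (by positivity), mul_left_comm, Real.mul_self_sqrt hG1.le] at h
    rw [mul_comm]
    convert h using 2
    ring
  have e1 : (2 * Real.pi) ^ (-((m:ℝ) + 1) / 2) * √Real.pi ^ m * (1/2:ℝ) ^ (-((m:ℝ) + 1) / 2) = (√Real.pi)⁻¹ := by
    rw [mul_right_comm, ← Real.mul_rpow (by positivity) (by positivity),
      show 2 * Real.pi * (1/2) = Real.pi by ring, neg_div, Real.rpow_neg hpi.le, Real.rpow_div_two_eq_sqrt _ hpi.le,
      ← Nat.cast_succ, Real.rpow_natCast, Nat.succ_eq_add_one, pow_succ]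
    field_simp
  have e2 : √(2 * Real.pi * (m + 1)) = 2 * √Real.pi * √(((m:ℝ) + 1) / 2) := by
    rw [show 2 * Real.pi * ((m:ℝ) + 1) = 2 ^ 2 * Real.pi * (((m:ℝ) + 1) / 2) by ring, Real.sqrt_mul (by positivity),
      Real.sqrt_mul (by positivity), Real.sqrt_sq (by norm_num)]
  have e3 : ((2 * Real.pi) ^ (-((m:ℝ) + 1) / 2) * (m * (√Real.pi ^ m / Real.Gamma (m / 2 + 1)) *
       ((1/2:ℝ) ^ (-((m:ℝ) + 1) / 2) * (1 / 2) * Real.Gamma (((m:ℝ) + 1) / 2)))) * (s ^ m / m)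
       = ((2 * Real.pi) ^ (-((m:ℝ) + 1) / 2) * √Real.pi ^ m * (1/2:ℝ) ^ (-((m:ℝ) + 1) / 2)) * (1/2)
        * Real.Gamma (((m:ℝ) + 1) / 2) / Real.Gamma (m / 2 + 1) * s ^ m := by
    field_simp
  rw [e3, e1, e2]
  have hsp := Real.sqrt_pos.2 hpi
  have hsq : 0 < √(((m:ℝ) + 1) / 2) := Real.sqrt_pos.2 (by positivity)
  have : 1 / √(((m:ℝ) + 1) / 2) ≤ Real.Gamma (((m:ℝ) + 1) / 2) / Real.Gamma (m / 2 + 1) := by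
    rw [div_le_div_iff₀ hsq hG2]; linarith
  calc s ^ m / (2 * √Real.pi * √(((m:ℝ) + 1) / 2)) = (√Real.pi)⁻¹ * (1/2) * (1 / √(((m:ℝ) + 1) / 2)) * s ^ m := by
        field_simp
    _ ≤ (√Real.pi)⁻¹ * (1/2) * (Real.Gamma (((m:ℝ) + 1) / 2) / Real.Gamma (m / 2 + 1)) * s ^ m := by gcongr
    _ = _ := by ring

/-- The Gaussian density on `ℝ × ℝ^m`, restricted to an open cone around the first axis. -/
noncomputable def coneDensity (m : ℕ) (K c : ℝ) (p : ℝ × EuclideanSpace ℝ (Fin m)) : ENNReal :=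
  {p : ℝ × EuclideanSpace ℝ (Fin m) | c * ‖p.2‖ < p.1}.indicator
    (fun p => ENNReal.ofReal (K * Real.exp (-(p.1 ^ 2 + ‖p.2‖ ^ 2) / 2))) p

lemma coneDensity_measurable (m : ℕ) (K c : ℝ) : Measurable (coneDensity m K c) := by
  unfold coneDensity
  refine Measurable.indicator (by fun_prop) ?_
  exact measurableSet_lt (by fun_prop) (by fun_prop)

lemma aux_reduce (m : ℕ) (α : ℝ) (hα : 0 < α) (hα' : α < Real.pi / 2)
    (w : EuclideanSpace ℝ (Fin (m+1))) (hw : ‖w‖ = 1) :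
    ∫⁻ y : EuclideanSpace ℝ (Fin m), ∫⁻ t : ℝ,
      coneDensity m ((2 * Real.pi) ^ (-((m:ℝ) + 1) / 2)) (Real.cos α / Real.sin α) (t, y) ≤
      gaussianMeasure (m+1) {x | ‖x‖ * Real.cos α ≤ ⟪x, w⟫} := by
  have hs : 0 < Real.sin α := Real.sin_pos_of_pos_of_lt_pi hα (by linarith)
  have hc : 0 < Real.cos α := Real.cos_pos_of_mem_Ioo ⟨by linarith, hα'⟩
  obtain ⟨Φ, hΦ, h1, h2⟩ := aux_split m w hw
  have hmeas := coneDensity_measurable m ((2 * Real.pi) ^ (-((m:ℝ) + 1) / 2)) (Real.cos α / Real.sin α)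
  rw [← lintegral_prod_symm _ hmeas.aemeasurable, ← Measure.volume_eq_prod, ← hΦ.lintegral_comp hmeas]
  have hC : MeasurableSet {x : EuclideanSpace ℝ (Fin (m+1)) | ‖x‖ * Real.cos α ≤ ⟪x, w⟫} :=
    measurableSet_le (by fun_prop) (by fun_prop)
  rw [gaussianMeasure, withDensity_apply _ hC, ← lintegral_indicator hC]
  refine lintegral_mono fun x => ?_
  unfold coneDensity
  by_cases hx : Φ x ∈ {p : ℝ × EuclideanSpace ℝ (Fin m) | Real.cos α / Real.sin α * ‖p.2‖ < p.1}
  · have hx' : x ∈ {x : EuclideanSpace ℝ (Fin (m+1)) | ‖x‖ * Real.cos α ≤ ⟪x, w⟫} := by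
      simp only [Set.mem_ofPred_eq] at hx ⊢
      rw [← h1]
      have hp : 0 ≤ (Φ x).1 := le_trans (by positivity) hx.le
      refine abs_le_of_sq_le_sq' ?_ hp |>.2
      rw [mul_pow, h2]
      have h3 : Real.cos α * ‖(Φ x).2‖ ≤ (Φ x).1 * Real.sin α := by
        rw [div_mul_eq_mul_div, div_lt_iff₀ hs] at hx
        exact hx.le
      have h4 := pow_le_pow_left₀ (by positivity) h3 2
      have h5 := Real.sin_sq_add_cos_sq α
      rw [mul_pow, mul_pow] at h4
      have h6 : (Φ x).1 ^ 2 = (Φ x).1 ^ 2 * (Real.sin α ^ 2 + Real.cos α ^ 2) := by rw [h5, mul_one]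
      nlinarith
    rw [Set.indicator_of_mem hx, Set.indicator_of_mem hx', ← h2]
    push_cast
    rfl
  · rw [Set.indicator_of_notMem hx]
    exact zero_le

lemma aux_zero (c : ℝ) :
    ENNReal.ofReal (1 / √(2 * Real.pi)) ≤ ∫⁻ y : EuclideanSpace ℝ (Fin 0), ∫⁻ t : ℝ,
      coneDensity 0 ((2 * Real.pi) ^ (-(1:ℝ) / 2)) c (t, y) := by
  have h : ∀ y : EuclideanSpace ℝ (Fin 0), ∫⁻ t : ℝ,
      coneDensity 0 ((2 * Real.pi) ^ (-(1:ℝ) / 2)) c (t, y) = ENNReal.ofReal (1/2) := by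
    intro y
    have e : (fun t : ℝ => coneDensity 0 ((2 * Real.pi) ^ (-(1:ℝ) / 2)) c (t, y)) =
      (Set.Ioi (0:ℝ)).indicator
        (fun t => ENNReal.ofReal ((2 * Real.pi) ^ (-(1:ℝ) / 2) * Real.exp (-(1/2) * t ^ 2))) := by
      ext t
      have hy : ‖y‖ = 0 := by rw [Subsingleton.elim y 0, norm_zero]
      simp only [coneDensity, Set.indicator, Set.mem_ofPred_eq, Set.mem_Ioi, hy, mul_zero]
      congr 4
      ring
    rw [e, lintegral_indicator measurableSet_Ioi, ← ofReal_integral_eq_lintegral_ofReal]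
    · rw [integral_const_mul, integral_gaussian_Ioi, neg_div, Real.rpow_neg (by positivity),
        ← Real.sqrt_eq_rpow]
      congr 1
      rw [show Real.pi / (1/2) = 2 * Real.pi by ring]
      have : 0 < √(2 * Real.pi) := Real.sqrt_pos.2 (by positivity)
      field_simp
    · exact ((integrable_exp_neg_mul_sq (by norm_num)).const_mul _).integrableOn
    · exact .of_forall fun t => by positivity
  simp_rw [h]
  rw [lintegral_const]
  have hv : volume (Set.univ : Set (EuclideanSpace ℝ (Fin 0))) = 1 := by
    have := (PiLp.volume_preserving_toLp (Fin 0)).measure_preimage (s := Set.univ) (by simp)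
    rw [← this, Set.preimage_univ, volume_pi, Measure.pi_univ]
    simp
  rw [hv, mul_one]
  refine ENNReal.ofReal_le_ofReal ?_
  refine one_div_le_one_div_of_le two_pos ?_
  exact Real.le_sqrt_of_sq_le (by nlinarith [Real.pi_gt_three])

lemma aux_pos (m : ℕ) (hm : 1 ≤ m) (K c : ℝ) (hK : 0 < K) :
    ∫⁻ y : EuclideanSpace ℝ (Fin m), ∫⁻ t : ℝ, coneDensity m K c (t, y) =
    ENNReal.ofReal (K * (m * (√Real.pi ^ m / Real.Gamma (m / 2 + 1)) *
       ((1/2:ℝ) ^ (-((m:ℝ) + 1) / 2) * (1 / 2) * Real.Gamma (((m:ℝ) + 1) / 2)))) *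
    ∫⁻ u in Set.Ioi c, ENNReal.ofReal ((1 + u ^ 2) ^ (-((m:ℝ) + 1) / 2)) := by
  have : Nonempty (Fin m) := ⟨⟨0, hm⟩⟩
  have : Nontrivial (EuclideanSpace ℝ (Fin m)) := inferInstance
  have hmeas := coneDensity_measurable m K c
  have h1 : ∀ᵐ y : EuclideanSpace ℝ (Fin m), ∫⁻ t : ℝ, coneDensity m K c (t, y) =
      ∫⁻ u in Set.Ioi c, ENNReal.ofReal K *
        ENNReal.ofReal (‖y‖ * Real.exp (-((1 + u ^ 2) * (1/2)) * ‖y‖ ^ 2)) := by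
    have h0 : ∀ᵐ y : EuclideanSpace ℝ (Fin m), y ≠ 0 := by
      simp [ae_iff]
    filter_upwards [h0] with y hy
    have hr : 0 < ‖y‖ := norm_pos_iff.2 hy
    rw [aux_scale (fun t => coneDensity m K c (t, y)) (by fun_prop) ‖y‖ hr, ← lintegral_indicator measurableSet_Ioi,
      ← lintegral_const_mul _ (by fun_prop)]
    congr 1
    ext u
    simp only [coneDensity, Set.indicator, Set.mem_ofPred_eq, Set.mem_Ioi]
    have : c * ‖y‖ < ‖y‖ * u ↔ c < u := by rw [mul_comm, mul_lt_mul_iff_right₀ hr]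
    simp only [this]
    split_ifs
    · rw [← ENNReal.ofReal_mul hr.le, ← ENNReal.ofReal_mul hK.le]
      congr 1
      rw [show -((‖y‖ * u) ^ 2 + ‖y‖ ^ 2) / 2 = -((1 + u ^ 2) * (1/2)) * ‖y‖ ^ 2 by ring]
      ring
    · simp
  rw [lintegral_congr_ae h1, lintegral_lintegral_swap (by fun_prop), ← lintegral_const_mul _ (by fun_prop)]
  refine lintegral_congr fun u => ?_
  rw [lintegral_const_mul _ (by fun_prop), aux_norm m hm _ (by positivity), ← ENNReal.ofReal_mul hK.le,
    ← ENNReal.ofReal_mul]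
  · congr 1
    rw [Real.mul_rpow (by positivity) (by positivity)]
    ring
  · have hG1 : 0 < Real.Gamma (((m:ℝ) + 1) / 2) := Real.Gamma_pos_of_pos (by positivity)
    have hG2 : 0 < Real.Gamma ((m:ℝ) / 2 + 1) := Real.Gamma_pos_of_pos (by positivity)
    positivity

/-- If `α ∈ (0, π/2)` and `w` is a unit vector, then the convex cone
`C = {x : ⟪x, w⟫ ≥ ‖x‖ cos α}` has Gaussian measure at least `sin^{n-1}(α)/√(2πn)`. -/
theorem gaussian_measure_cone_lower_bound (n : ℕ) (α : ℝ) (hα : 0 < α) (hα' : α < Real.pi / 2)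
    (w : EuclideanSpace ℝ (Fin n)) (hw : ‖w‖ = 1) :
    ENNReal.ofReal (Real.sin α ^ (n - 1) / Real.sqrt (2 * Real.pi * n)) ≤
      gaussianMeasure n {x : EuclideanSpace ℝ (Fin n) | ‖x‖ * Real.cos α ≤ ⟪x, w⟫} := by
  obtain _ | m := n
  · rw [Subsingleton.elim w 0, norm_zero] at hw
    exact absurd hw zero_ne_one
  refine le_trans ?_ (aux_reduce m α hα hα' w hw)
  rcases Nat.eq_zero_or_pos m with rfl | hm
  · have := aux_zero (Real.cos α / Real.sin α)
    simpa using this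
  · rw [aux_pos m hm _ _ (by positivity)]
    have hs : 0 < Real.sin α := Real.sin_pos_of_pos_of_lt_pi hα (by linarith)
    refine le_trans ?_ (mul_le_mul_right (aux_tail m hm α hα hα') _)
    rw [← ENNReal.ofReal_mul']
    · refine ENNReal.ofReal_le_ofReal ?_
      have := aux_const m hm (Real.sin α) hs
      simpa only [Nat.add_sub_cancel, Nat.cast_add, Nat.cast_one] using this
    · positivity
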